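/- Let n ≥ 3, let F be a real antisymmetric n×n matrix, let A ∈ ℝⁿ and m ∈ ℝ. With the contracted Maxwell/Proca stress tensor T(t,t) = ∑_{a,b,c,d} t_a t_b F_{ac} η_{cd} F_{bd} − (1/4)·η(t,t)·(F·F) + m²·((∑_a A_a t_a)² − (1/2)·η(t,t)·η(A,A)) and the trace Tr = ((4−n)/4)·(F·F) + ((2−n)/2)·m²·η(A,A), where F·F = ∑_{c,d,e,f} F_{cd} η_{ce} η_{df} F_{ef}, one has T(t,t) − (Tr/(n−2))·η(t,t) ≥ 0 for every timelike vector t ∈ ℝⁿ: the Maxwell and Proca fields satisfy the strong energy condition pointwise, off-shell, in dimension n > 2. -/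

import Mathlib

open scoped BigOperators

/-- The Minkowski bilinear form on `ℝⁿ`: `η(x,y) = -x₀y₀ + ∑_{i≥1} xᵢyᵢ`. -/
def minkowski {n : ℕ} (x y : Fin n → ℝ) : ℝ :=
  ∑ i : Fin n, (if (i : ℕ) = 0 then (-1 : ℝ) else 1) * x i * y i

/-- The Minkowski metric matrix `diag(−1,1,…,1)`. -/
def etaMat (n : ℕ) : Matrix (Fin n) (Fin n) ℝ :=
  fun i j => if i = j then (if (i : ℕ) = 0 then -1 else 1) else 0

/-- The full contraction `F^{cd} F_{cd} = ∑ F_{cd} η_{ce} η_{df} F_{ef}`. -/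
def FdotF {n : ℕ} (F : Matrix (Fin n) (Fin n) ℝ) : ℝ :=
  ∑ c : Fin n, ∑ d : Fin n, ∑ e : Fin n, ∑ f : Fin n,
    F c d * etaMat n c e * etaMat n d f * F e f

/-- The Maxwell/Proca stress tensor contracted with vectors `t` and `u`:
`T(t,u) = ∑ t_a u_b F_{ac} η_{cd} F_{bd} − (1/4) η(t,u) F·F
          + m² ((A·t)(A·u) − (1/2) η(t,u) η(A,A))`. -/
noncomputable def procaT {n : ℕ} (F : Matrix (Fin n) (Fin n) ℝ) (A : Fin n → ℝ) (m : ℝ)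
    (t u : Fin n → ℝ) : ℝ :=
  (∑ a : Fin n, ∑ b : Fin n, ∑ c : Fin n, ∑ d : Fin n,
      t a * u b * F a c * etaMat n c d * F b d)
    - (1/4) * minkowski t u * FdotF F
    + m^2 * ((∑ a : Fin n, A a * t a) * (∑ b : Fin n, A b * u b)
              - (1/2) * minkowski t u * minkowski A A)

open Matrix in
lemma rev_cs {n : ℕ} (hn : 3 ≤ n) (t x : Fin n → ℝ) (ht : minkowski t t < 0) :
    0 ≤ (-minkowski t t) * minkowski x x + (∑ a, t a * x a) ^ 2 := by
  obtain ⟨k, rfl⟩ : ∃ k, n = k + 1 := ⟨n - 1, by omega⟩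
  have hm : ∀ y : Fin (k+1) → ℝ, minkowski y y = - y 0 ^ 2 + ∑ i : Fin k, y i.succ ^ 2 := by
    intro y
    simp [minkowski, Fin.sum_univ_succ, pow_two]
  rw [hm] at ht
  rw [hm, hm, Fin.sum_univ_succ]
  have hcs := Finset.sum_mul_sq_le_sq_mul_sq Finset.univ
    (fun i : Fin k => t i.succ) (fun i : Fin k => x i.succ)
  have hV : 0 ≤ ∑ i : Fin k, t i.succ ^ 2 := Finset.sum_nonneg fun i _ => sq_nonneg _
  have hY : 0 ≤ ∑ i : Fin k, x i.succ ^ 2 := Finset.sum_nonneg fun i _ => sq_nonneg _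
  generalize (∑ i : Fin k, t i.succ ^ 2) = V at *
  generalize (∑ i : Fin k, x i.succ ^ 2) = Y at *
  generalize (∑ i : Fin k, t i.succ * x i.succ) = P at *
  generalize t 0 = a at *
  generalize x 0 = b at *
  rcases hV.eq_or_lt with h | h
  · subst h
    have hP : P = 0 := by nlinarith [sq_nonneg P]
    subst hP
    nlinarith [mul_nonneg hY (sq_nonneg a)]
  · have key : 0 ≤ V * (-(-a ^ 2 + V) * (-b ^ 2 + Y) + (a * b + P) ^ 2) := by
      nlinarith [sq_nonneg (b * V + a * P),
        mul_nonneg (sub_nonneg.2 hcs) (show 0 ≤ a ^ 2 - V by linarith)]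
    exact nonneg_of_mul_nonneg_right key h

lemma etaMat_eq (n : ℕ) : etaMat n =
    Matrix.diagonal (fun i : Fin n => if (i : ℕ) = 0 then (-1 : ℝ) else 1) := by
  ext i j
  simp [etaMat, Matrix.diagonal_apply]

lemma minkowski_eq {n : ℕ} (x y : Fin n → ℝ) :
    minkowski x y = x ⬝ᵥ (etaMat n).mulVec y := by
  rw [etaMat_eq]
  simp only [minkowski, dotProduct, Matrix.mulVec_diagonal]
  exact Finset.sum_congr rfl fun i _ => by ring

open Matrix in
lemma FdotF_eq {n : ℕ} (F : Matrix (Fin n) (Fin n) ℝ) :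
    FdotF F = (etaMat n * F * etaMat n * Fᵀ).trace := by
  rw [FdotF]
  simp only [etaMat_eq, Matrix.trace, Matrix.diag, Matrix.mul_apply (N := Fᵀ),
    Matrix.mul_diagonal, Matrix.diagonal_mul, Matrix.transpose_apply]
  refine Finset.sum_congr rfl fun c _ => Finset.sum_congr rfl fun d _ => ?_
  simp [Matrix.diagonal_apply, mul_ite, ite_mul]
  try split_ifs <;> ring

open Matrix in
lemma first_eq {n : ℕ} (F : Matrix (Fin n) (Fin n) ℝ) (t : Fin n → ℝ) :
    (∑ a : Fin n, ∑ b : Fin n, ∑ c : Fin n, ∑ d : Fin n,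
      t a * t b * F a c * etaMat n c d * F b d) = minkowski (t ᵥ* F) (t ᵥ* F) := by
  have : ∀ a b c : Fin n, ∑ d : Fin n, t a * t b * F a c * etaMat n c d * F b d
      = (if (c : ℕ) = 0 then (-1 : ℝ) else 1) * (t a * F a c) * (t b * F b c) := by
    intro a b c
    simp [etaMat, mul_ite, ite_mul]
    try split_ifs <;> ring
  simp only [this, minkowski, Matrix.vecMul, dotProduct]
  have e : ∀ c : Fin n, (if (c : ℕ) = 0 then (-1 : ℝ) else 1) * (∑ a, t a * F a c) * (∑ b, t b * F b c)
     = ∑ a, ∑ b, (if (c : ℕ) = 0 then (-1 : ℝ) else 1) * (t a * F a c) * (t b * F b c) := by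
    intro c
    rw [mul_assoc, Finset.sum_mul_sum, Finset.mul_sum]
    refine Finset.sum_congr rfl fun a _ => ?_
    rw [Finset.mul_sum]
    exact Finset.sum_congr rfl fun b _ => by ring
  simp only [e]
  rw [Finset.sum_comm (s := (Finset.univ : Finset (Fin n))) (f := fun c a => ∑ b, (if (c : ℕ) = 0 then (-1 : ℝ) else 1) * (t a * F a c) * (t b * F b c))]
  exact Finset.sum_congr rfl fun a _ => Finset.sum_comm

open Matrix in
lemma mag_nonneg {n : ℕ} (hn : 3 ≤ n) (F : Matrix (Fin n) (Fin n) ℝ)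
    (hF : ∀ a b : Fin n, F a b = -F b a) (t : Fin n → ℝ) (ht : minkowski t t < 0) :
    0 ≤ (-minkowski t t) * FdotF F + 2 * minkowski (t ᵥ* F) (t ᵥ* F) ∧
    0 ≤ minkowski (t ᵥ* F) (t ᵥ* F) := by
  have hFt : Fᵀ = -F := by ext a b; simpa using hF b a
  have hv : F *ᵥ t = -(t ᵥ* F) := by
    rw [← Matrix.mulVec_transpose, hFt, Matrix.neg_mulVec, neg_neg]
  have horth : (t ᵥ* F) ⬝ᵥ t = 0 := by
    have h1 : (t ᵥ* F) ⬝ᵥ t = t ⬝ᵥ (F *ᵥ t) := (Matrix.dotProduct_mulVec _ _ _).symm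
    rw [hv, dotProduct_neg, dotProduct_comm t] at h1
    linarith
  have hQ : 0 < -minkowski t t := by linarith
  constructor
  swap
  · have h := rev_cs hn t (t ᵥ* F) ht
    have h0 : ∑ a, t a * (t ᵥ* F) a = 0 := by rw [← horth, dotProduct_comm]; rfl
    rw [h0] at h
    refine nonneg_of_mul_nonneg_right (a := -minkowski t t) ?_ hQ
    simpa using h
  set Q := -minkowski t t with hQd
  set h : Matrix (Fin n) (Fin n) ℝ := Q • etaMat n + vecMulVec t t with hh
  have hpsd : h.PosSemidef := by
    refine Matrix.PosSemidef.of_dotProduct_mulVec_nonneg ?_ ?_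
    · rw [Matrix.IsHermitian, hh, etaMat_eq]
      ext i j
      by_cases hij : i = j
      · subst hij; simp
      · simp [Matrix.diagonal_apply, hij, Ne.symm hij, vecMulVec_apply, mul_comm, Ne.symm (show i ≠ j from hij)]
    · intro x
      have := rev_cs hn t x ht
      rw [hh, Matrix.add_mulVec, dotProduct_add, Matrix.smul_mulVec, dotProduct_smul, star_trivial,
        ← minkowski_eq, Matrix.vecMulVec_mulVec]
      have e : t ⬝ᵥ x = ∑ a, t a * x a := rfl
      rw [← e] at this
      simpa [dotProduct_comm x t, pow_two, hQd] using this
  obtain ⟨B, hB⟩ : ∃ B : Matrix (Fin n) (Fin n) ℝ, h = Bᴴ * B := by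
    open scoped MatrixOrder in
    exact CStarAlgebra.nonneg_iff_eq_star_mul_self.mp (Matrix.nonneg_iff_posSemidef.2 hpsd)
  have htr : 0 ≤ (h * F * h * Fᵀ).trace := by
    have p := (hpsd.mul_mul_conjTranspose_same (B * F)).trace_nonneg
    rw [Matrix.conjTranspose_mul] at p
    have e : (h * F * h * Fᵀ).trace = (B * F * h * (Fᴴ * Bᴴ)).trace := by
      calc (h * F * h * Fᵀ).trace = (Bᴴ * (B * F * h * Fᴴ)).trace := by
            rw [Matrix.conjTranspose_eq_transpose_of_trivial F]
            nth_rewrite 1 [hB]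
            simp only [Matrix.mul_assoc]
        _ = _ := by rw [Matrix.trace_mul_comm]; simp only [Matrix.mul_assoc]
    rw [e]; exact p
  have e1 : (vecMulVec t t * F * etaMat n * Fᵀ).trace = minkowski (t ᵥ* F) (t ᵥ* F) := by
    rw [minkowski_eq, Matrix.vecMulVec_mul, Matrix.vecMulVec_mul, Matrix.vecMulVec_mul,
      Matrix.trace_vecMulVec, Matrix.vecMul_transpose,
      Matrix.dotProduct_mulVec, dotProduct_comm, ← Matrix.dotProduct_mulVec]
  have e2 : (etaMat n * F * vecMulVec t t * Fᵀ).trace = minkowski (t ᵥ* F) (t ᵥ* F) := by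
    rw [Matrix.mul_vecMulVec, Matrix.vecMulVec_mul, Matrix.trace_vecMulVec,
      Matrix.vecMul_transpose, hv, minkowski_eq, ← Matrix.mulVec_mulVec, hv, dotProduct_comm]
    simp [Matrix.mulVec_neg]
  have e3 : (vecMulVec t t * F * vecMulVec t t * Fᵀ).trace = 0 := by
    rw [Matrix.vecMulVec_mul, Matrix.vecMulVec_mul_vecMulVec, horth]
    simp
  have : (h * F * h * Fᵀ).trace = Q * (Q * FdotF F + 2 * minkowski (t ᵥ* F) (t ᵥ* F)) := by
    rw [hh, FdotF_eq]
    simp only [Matrix.add_mul, Matrix.mul_add, Matrix.smul_mul, Matrix.mul_smul, Matrix.trace_add,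
      Matrix.trace_smul, e1, e2, e3, smul_eq_mul]
    ring
  rw [this] at htr
  exact nonneg_of_mul_nonneg_right htr hQ

/-- The Maxwell/Proca field satisfies the strong energy condition pointwise,
off-shell, in dimension `n ≥ 3`: `T(t,t) − (Tr/(n−2)) η(t,t) ≥ 0` for every timelike `t`,
where `Tr = ((4−n)/4) F·F + ((2−n)/2) m² η(A,A)`. -/
theorem maxwell_proca_sec
    (n : ℕ) (hn : 3 ≤ n) (F : Matrix (Fin n) (Fin n) ℝ)
    (hF : ∀ a b : Fin n, F a b = -F b a)
    (A : Fin n → ℝ) (m : ℝ) :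
    ∀ t : Fin n → ℝ, minkowski t t < 0 →
      0 ≤ procaT F A m t t
          - ((((4 - (n : ℝ))/4) * FdotF F
                + (((2 : ℝ) - (n : ℝ))/2) * m^2 * minkowski A A) / ((n : ℝ) - 2))
              * minkowski t t := by
  intro t ht
  obtain ⟨h1, h2⟩ := mag_nonneg hn F hF t ht
  have hk : (1 : ℝ) ≤ (n : ℝ) - 2 := by
    have : (3 : ℝ) ≤ n := by exact_mod_cast hn
    linarith
  rw [procaT, first_eq]
  have hAt : 0 ≤ m ^ 2 * (∑ a : Fin n, A a * t a) ^ 2 := by positivity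
  generalize minkowski (Matrix.vecMul t F) (Matrix.vecMul t F) = E at *
  generalize minkowski t t = q at *
  generalize FdotF F = G at *
  generalize minkowski A A = a at *
  generalize (∑ a : Fin n, A a * t a) = p at *
  obtain ⟨k, hkd⟩ : ∃ k : ℝ, (n : ℝ) = k + 2 := ⟨n - 2, by ring⟩
  rw [hkd] at hk ⊢
  have hk1 : 1 ≤ k := by linarith
  have hk0 : 0 < k := by linarith
  have e : E - 1 / 4 * q * G + m ^ 2 * (p * p - 1 / 2 * q * a) -
      ((4 - (k + 2)) / 4 * G + (2 - (k + 2)) / 2 * m ^ 2 * a) / (k + 2 - 2) * q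
      = ((k - 1) * E + (-q * G + 2 * E) / 2) / k + m ^ 2 * p ^ 2 := by
    rw [show k + 2 - 2 = k by ring]
    field_simp
    ring
  rw [e]
  have : 0 ≤ (k - 1) * E := mul_nonneg (by linarith) h2
  positivity
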